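/- arXiv:2206.06945 — 11 statements merged into one kernel-verified Lean document; each statement's English description precedes it below -/
import Mathlib

section
/- Let b ∈ ℝⁿ and let T be a diagonal n×n real matrix with diagonal entries t_ii ∉ {0, −1} for all i. Then the piecewise linear system x⁺ + Tx = b has no solution if and only if there exists an index i such that −1 < t_ii < 0 and b_i < 0. -/
/-- The componentwise positive part `x⁺` of a vector. -/
noncomputable def vecPos {n : ℕ} (x : Fin n → ℝ) : Fin n → ℝ := fun i => max (x i) 0

/-- The scalar equation `x⁺ + tx = b` is solvable unless `−1 < t < 0` and `b < 0`. -/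
lemma exists_max_zero_add_mul_eq_iff {t b : ℝ} (h0 : t ≠ 0) (h1 : t ≠ -1) :
    (∃ x : ℝ, max x 0 + t * x = b) ↔ ¬ ((-1 < t ∧ t < 0) ∧ b < 0) := by
  have h1' : 1 + t ≠ 0 := fun h => h1 (by linarith)
  constructor
  · rintro ⟨x, rfl⟩ ⟨⟨ht, ht0⟩, hb⟩
    rcases le_total x 0 with hx | hx
    · rw [max_eq_right hx] at hb
      nlinarith
    · rw [max_eq_left hx] at hb
      nlinarith
  · intro h
    by_cases hpos : 0 ≤ b / (1 + t)
    · refine ⟨b / (1 + t), ?_⟩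
      rw [max_eq_left hpos]
      field_simp
    by_cases hneg : b / t ≤ 0
    · refine ⟨b / t, ?_⟩
      rw [max_eq_right hneg]
      field_simp
      ring
    rw [not_le] at hpos hneg
    rcases div_pos_iff.1 hneg with ⟨hb, ht⟩ | ⟨hb, ht⟩ <;>
      rcases div_neg_iff.1 hpos with ⟨hb', ht'⟩ | ⟨hb', ht'⟩
    · linarith
    · linarith
    · linarith
    · exact absurd ⟨⟨by linarith, ht⟩, hb⟩ h

/-- For a diagonal matrix `T = diag(t)` with `tᵢᵢ ∉ {0, −1}`, the piecewise linear system
`x⁺ + Tx = b` has no solution if and only if `−1 < tᵢᵢ < 0` and `bᵢ < 0` for some `i`. -/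
theorem stmt3 {n : ℕ} (b t : Fin n → ℝ)
    (h0 : ∀ i, t i ≠ 0) (h1 : ∀ i, t i ≠ -1) :
    (¬ ∃ x : Fin n → ℝ, vecPos x + (Matrix.diagonal t).mulVec x = b) ↔
      ∃ i, (-1 < t i ∧ t i < 0) ∧ b i < 0 := by
  have hsolv : (∃ x : Fin n → ℝ, vecPos x + (Matrix.diagonal t).mulVec x = b) ↔
      ∀ i, ∃ x : ℝ, max x 0 + t i * x = b i := by
    simp only [funext_iff, Pi.add_apply, Matrix.mulVec_diagonal, vecPos, Classical.skolem]
  simp only [hsolv, exists_max_zero_add_mul_eq_iff (h0 _) (h1 _), not_forall, not_not]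
end

section
/- Let b ∈ ℝⁿ and let T be a diagonal n×n real matrix with diagonal entries t_ii ∉ {0, −1} for all i, and assume b_i ≥ 0 for every index i with −1 < t_ii < 0 (so that the system x⁺ + Tx = b has a solution). Then for any starting point x⁰ ∈ ℝⁿ, the semi-smooth Newton iterates x¹ = (P(x⁰) + T)^{-1} b and x² = (P(x¹) + T)^{-1} b are well defined and x² solves the system, i.e., (x²)⁺ + T x² = b. -/
/-- The diagonal matrix `P(x)` with `i`-th diagonal entry `sgn(xᵢ⁺)`,
i.e. `1` if `xᵢ > 0` and `0` otherwise. -/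
noncomputable def Pmat {n : ℕ} (x : Fin n → ℝ) : Matrix (Fin n) (Fin n) ℝ :=
  Matrix.diagonal fun i => if 0 < x i then 1 else 0

/-- Two steps of the scalar semi-smooth Newton iteration solve `max x 0 + t x = b`. -/
theorem max_add_mul_eq_of_newton_two_steps {b t x0 x1 x2 : ℝ} (h0 : t ≠ 0) (h1 : t ≠ -1)
    (hb : -1 < t → t < 0 → 0 ≤ b)
    (hx1 : ((if 0 < x0 then 1 else 0) + t) * x1 = b)
    (hx2 : ((if 0 < x1 then 1 else 0) + t) * x2 = b) :
    max x2 0 + t * x2 = b := by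
  have h1' : 1 + t ≠ 0 := fun h => h1 (by linarith)
  by_cases p1 : 0 < x1
  · suffices 0 ≤ x2 by
      rw [max_eq_left this]
      rw [if_pos p1] at hx2
      linarith
    rw [if_pos p1] at hx2
    by_cases p0 : 0 < x0
    · rw [if_pos p0] at hx1
      exact (mul_left_cancel₀ h1' (hx1.trans hx2.symm)) ▸ p1.le
    · rw [if_neg p0, zero_add] at hx1
      rcases lt_or_gt_of_ne h0 with ht | ht
      · rcases lt_or_gt_of_ne h1 with ht' | ht'
        · by_contra! hneg
          nlinarith [mul_pos_of_neg_of_neg (show 1 + t < 0 by linarith) hneg,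
            mul_neg_of_neg_of_pos ht p1]
        · linarith [hb ht' ht, mul_neg_of_neg_of_pos ht p1]
      · by_contra! hneg
        nlinarith [mul_neg_of_pos_of_neg (show 0 < 1 + t by linarith) hneg, mul_pos ht p1]
  · suffices x2 ≤ 0 by
      rw [max_eq_right this]
      rw [if_neg p1] at hx2
      linarith
    rw [if_neg p1, zero_add] at hx2
    rw [not_lt] at p1
    by_cases p0 : 0 < x0
    · rw [if_pos p0] at hx1
      by_contra! hpos
      rcases lt_or_gt_of_ne h0 with ht | ht
      · rcases lt_or_gt_of_ne h1 with ht' | ht'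
        · nlinarith [mul_nonneg_of_nonpos_of_nonpos (show 1 + t ≤ 0 by linarith) p1,
            mul_neg_of_neg_of_pos ht hpos]
        · linarith [hb ht' ht, mul_neg_of_neg_of_pos ht hpos]
      · nlinarith [mul_nonpos_of_nonneg_of_nonpos (show 0 ≤ 1 + t by linarith) p1,
          mul_pos ht hpos]
    · rw [if_neg p0, zero_add] at hx1
      exact (mul_left_cancel₀ h0 (hx1.trans hx2.symm)) ▸ p1

theorem isUnit_det_Pmat_add_diagonal {n : ℕ} {t : Fin n → ℝ}
    (h0 : ∀ i, t i ≠ 0) (h1 : ∀ i, t i ≠ -1) (x : Fin n → ℝ) :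
    IsUnit (Pmat x + Matrix.diagonal t).det := by
  rw [Pmat, Matrix.diagonal_add, Matrix.det_diagonal, isUnit_iff_ne_zero, Finset.prod_ne_zero_iff]
  intro i _
  split_ifs
  · exact fun h => h1 i (by linarith)
  · simpa using h0 i

theorem existsUnique_mulVec_eq_of_isUnit_det {m R : Type*} [Fintype m] [DecidableEq m]
    [CommRing R] {A : Matrix m m R} (hA : IsUnit A.det) (b : m → R) :
    ∃! x : m → R, A.mulVec x = b := by
  refine ⟨A⁻¹.mulVec b, ?_, ?_⟩
  · simp [Matrix.mul_nonsing_inv _ hA]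
  · rintro y rfl
    simp [Matrix.nonsing_inv_mul _ hA]

/-- For a diagonal matrix `T = diag(t)` with `tᵢᵢ ∉ {0, −1}` and `bᵢ ≥ 0` whenever
`−1 < tᵢᵢ < 0`, starting from any `x⁰` the semi-smooth Newton iterates
`x¹ = (P(x⁰) + T)⁻¹ b` and `x² = (P(x¹) + T)⁻¹ b` are well defined (the Newton
matrices are invertible and the steps uniquely solvable), and `x²` solves the
piecewise linear system `x⁺ + Tx = b`. -/
theorem stmt4 {n : ℕ} (b t : Fin n → ℝ)
    (h0 : ∀ i, t i ≠ 0) (h1 : ∀ i, t i ≠ -1)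
    (hb : ∀ i, -1 < t i → t i < 0 → 0 ≤ b i)
    (x0 : Fin n → ℝ) :
    IsUnit (Pmat x0 + Matrix.diagonal t).det ∧
    (∃! x1 : Fin n → ℝ, (Pmat x0 + Matrix.diagonal t).mulVec x1 = b) ∧
    ∀ x1 : Fin n → ℝ, (Pmat x0 + Matrix.diagonal t).mulVec x1 = b →
      IsUnit (Pmat x1 + Matrix.diagonal t).det ∧
      (∃! x2 : Fin n → ℝ, (Pmat x1 + Matrix.diagonal t).mulVec x2 = b) ∧
      ∀ x2 : Fin n → ℝ, (Pmat x1 + Matrix.diagonal t).mulVec x2 = b →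
        vecPos x2 + (Matrix.diagonal t).mulVec x2 = b := by
  have hu := isUnit_det_Pmat_add_diagonal h0 h1
  refine ⟨hu x0, existsUnique_mulVec_eq_of_isUnit_det (hu x0) b, fun x1 hx1 =>
    ⟨hu x1, existsUnique_mulVec_eq_of_isUnit_det (hu x1) b, fun x2 hx2 => funext fun i => ?_⟩⟩
  rw [Pmat, Matrix.diagonal_add] at hx1 hx2
  have e1 := congrFun hx1 i
  have e2 := congrFun hx2 i
  rw [Matrix.mulVec_diagonal] at e1 e2
  rw [Pi.add_apply, Matrix.mulVec_diagonal]
  exact max_add_mul_eq_of_newton_two_steps (h0 i) (h1 i) (hb i) e1 e2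
end

section
/- Let b ∈ ℝⁿ and let T be a diagonal n×n real matrix with diagonal entries t_ii ∉ {0, −1} for all i, and assume b_i ≥ 0 for every index i with −1 < t_ii < 0. Then the set of solutions of the piecewise linear system x⁺ + Tx = b is finite with exactly 2^r elements, where r is the number of indices i such that b_i > 0 and −1 < t_ii < 0. -/
/-- The scalar equation `x⁺ + t x = b` has two solutions when `0 < b` and `-1 < t < 0`,
and otherwise exactly one, provided `b` is nonnegative for `-1 < t < 0`. -/
theorem exists_finset_scalar_solutions (b t : ℝ) (h0 : t ≠ 0) (h1 : t ≠ -1)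
    (hb : -1 < t → t < 0 → 0 ≤ b) :
    ∃ s : Finset ℝ, (∀ x, x ∈ s ↔ max x 0 + t * x = b) ∧
      s.card = if 0 < b ∧ -1 < t ∧ t < 0 then 2 else 1 := by
  have h1' : 1 + t ≠ 0 := fun h => h1 (by linarith)
  have key (x : ℝ) : max x 0 + t * x = b ↔
      (0 ≤ x ∧ x = b / (1 + t)) ∨ (x ≤ 0 ∧ x = b / t) := by
    rw [eq_div_iff h1', eq_div_iff h0]
    rcases lt_trichotomy x 0 with hx | rfl | hx
    · rw [max_eq_right hx.le]
      simp [hx.le, not_le.mpr hx, mul_comm]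
    · simp
    · rw [max_eq_left hx.le]
      simp only [hx.le, not_le.mpr hx, true_and, false_and, or_false]
      ring_nf
  simp only [key]
  split_ifs with h
  · obtain ⟨hbpos, ht, ht'⟩ := h
    have hpos : 0 < b / (1 + t) := div_pos hbpos (by linarith)
    have hneg : b / t < 0 := div_neg_of_pos_of_neg hbpos ht'
    refine ⟨{b / (1 + t), b / t}, fun x => ?_, Finset.card_pair (by linarith)⟩
    simp only [Finset.mem_insert, Finset.mem_singleton]
    constructor
    · rintro (rfl | rfl)
      · exact Or.inl ⟨hpos.le, rfl⟩
      · exact Or.inr ⟨hneg.le, rfl⟩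
    · rintro (⟨-, hx⟩ | ⟨-, hx⟩)
      · exact Or.inl hx
      · exact Or.inr hx
  · rcases eq_or_ne b 0 with rfl | hne
    · refine ⟨{0}, fun x => ?_, Finset.card_singleton _⟩
      simp only [zero_div, Finset.mem_singleton]
      grind
    have hsign : 0 < t * (1 + t) := by
      rcases lt_or_gt_of_ne h0 with ht | ht
      · rcases lt_or_gt_of_ne h1 with ht' | ht'
        · exact mul_pos_of_neg_of_neg ht (by linarith)
        · exact absurd ⟨(hb ht' ht).lt_of_ne' hne, ht', ht⟩ h
      · positivity
    have hprod : 0 < b / t * (b / (1 + t)) := by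
      rw [div_mul_div_comm]
      exact div_pos (mul_self_pos.mpr hne) hsign
    rcases pos_and_pos_or_neg_and_neg_of_mul_pos hprod with ⟨hp, hq⟩ | ⟨hp, hq⟩
    · refine ⟨{b / (1 + t)}, fun x => ?_, Finset.card_singleton _⟩
      grind
    · refine ⟨{b / t}, fun x => ?_, Finset.card_singleton _⟩
      grind

/-- For a diagonal matrix `T = diag(t)` with `tᵢᵢ ∉ {0, −1}` and `bᵢ ≥ 0` whenever
`−1 < tᵢᵢ < 0`, the solution set of `x⁺ + Tx = b` is finite with exactly `2^r`
elements, where `r` is the number of indices `i` with `bᵢ > 0` and `−1 < tᵢᵢ < 0`. -/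
theorem stmt5 {n : ℕ} (b t : Fin n → ℝ)
    (h0 : ∀ i, t i ≠ 0) (h1 : ∀ i, t i ≠ -1)
    (hb : ∀ i, -1 < t i → t i < 0 → 0 ≤ b i) :
    {x : Fin n → ℝ | vecPos x + (Matrix.diagonal t).mulVec x = b}.Finite ∧
    {x : Fin n → ℝ | vecPos x + (Matrix.diagonal t).mulVec x = b}.ncard =
      2 ^ (Finset.univ.filter fun i => 0 < b i ∧ -1 < t i ∧ t i < 0).card := by
  choose s hs hcard using fun i => exists_finset_scalar_solutions (b i) (t i) (h0 i) (h1 i) (hb i)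
  have hset : {x : Fin n → ℝ | vecPos x + (Matrix.diagonal t).mulVec x = b} =
      (Fintype.piFinset s : Set (Fin n → ℝ)) := by
    ext x
    simp [hs, funext_iff, vecPos, Matrix.mulVec_diagonal]
  rw [hset]
  refine ⟨Finset.finite_toSet _, ?_⟩
  rw [Set.ncard_coe_finset, Fintype.card_piFinset]
  simp only [hcard]
  rw [Finset.prod_ite]
  simp
end

section
/- Let T be a symmetric positive definite n×n real matrix and b ∈ ℝⁿ. Then the piecewise linear system x⁺ + Tx = b has exactly one solution x ∈ ℝⁿ. -/
/-- A strongly monotone Lipschitz map on a real Hilbert space is surjective. -/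
theorem surjective_of_stronglyMonotone_of_lipschitz {E : Type*} [NormedAddCommGroup E]
    [InnerProductSpace ℝ E] [CompleteSpace E] {F : E → E} {c K : ℝ} (hc : 0 < c)
    (hK : 0 ≤ K) (hmono : ∀ x y, c * ‖x - y‖ ^ 2 ≤ inner ℝ (x - y) (F x - F y))
    (hlip : ∀ x y, ‖F x - F y‖ ≤ K * ‖x - y‖) : Function.Surjective F := by
  intro b
  obtain ⟨L, hKL, hcL⟩ : ∃ L, K ≤ L ∧ c < L := ⟨K + c + 1, by linarith, by linarith⟩
  have hL : 0 < L := hc.trans hcL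
  set t : ℝ := c / L ^ 2 with ht
  have ht0 : 0 < t := by positivity
  have htL : t * L ^ 2 = c := by rw [ht]; field_simp
  have htc : t * c < 1 := by
    rw [ht, div_mul_eq_mul_div, div_lt_one (by positivity)]
    nlinarith
  obtain ⟨q, hq2⟩ : ∃ q : NNReal, (q : ℝ) ^ 2 = 1 - t * c :=
    ⟨⟨√(1 - t * c), Real.sqrt_nonneg _⟩, Real.sq_sqrt (by linarith)⟩
  have hq1 : q < 1 := by
    rw [← NNReal.coe_lt_coe, NNReal.coe_one]
    nlinarith [q.coe_nonneg, mul_pos ht0 hc]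
  have hG : ContractingWith q (fun x => x - t • (F x - b)) := by
    refine ⟨hq1, LipschitzWith.of_dist_le_mul fun x y => ?_⟩
    rw [dist_eq_norm, dist_eq_norm]
    refine le_of_sq_le_sq ?_ (by positivity)
    have hsub : x - t • (F x - b) - (y - t • (F y - b)) = (x - y) - t • (F x - F y) := by
      module
    have h1 := hmono x y
    have h2 : ‖F x - F y‖ ^ 2 ≤ L ^ 2 * ‖x - y‖ ^ 2 := by
      rw [← mul_pow]
      exact pow_le_pow_left₀ (norm_nonneg _) ((hlip x y).trans (by gcongr)) 2
    rw [hsub, norm_sub_sq_real, inner_smul_right, norm_smul, mul_pow, mul_pow, hq2,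
      Real.norm_eq_abs, sq_abs]
    have h3 := mul_le_mul_of_nonneg_left h1 ht0.le
    have h4 := mul_le_mul_of_nonneg_left h2 (sq_nonneg t)
    have h5 : t ^ 2 * (L ^ 2 * ‖x - y‖ ^ 2) = t * c * ‖x - y‖ ^ 2 := by
      rw [← htL]; ring
    linarith
  refine ⟨hG.fixedPoint, ?_⟩
  have hfix : _ - t • (F _ - b) = _ := hG.fixedPoint_isFixedPt
  rw [sub_eq_self, smul_eq_zero_iff_right ht0.ne', sub_eq_zero] at hfix
  exact hfix

/-- On a finite-dimensional space, a positive definite operator is coercive. -/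
theorem exists_pos_mul_norm_sq_le_inner {E : Type*} [NormedAddCommGroup E]
    [InnerProductSpace ℝ E] [FiniteDimensional ℝ E] (A : E →L[ℝ] E)
    (hA : ∀ x, x ≠ 0 → 0 < inner ℝ x (A x)) :
    ∃ c, 0 < c ∧ ∀ x, c * ‖x‖ ^ 2 ≤ inner ℝ x (A x) := by
  rcases subsingleton_or_nontrivial E with hE | hE
  · exact ⟨1, one_pos, fun x => by simp [Subsingleton.elim x 0]⟩
  obtain ⟨u, hu, hmin⟩ := (isCompact_sphere (0 : E) 1).exists_isMinOn
    (NormedSpace.sphere_nonempty.2 zero_le_one)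
    (f := fun x => inner ℝ x (A x)) (by fun_prop)
  refine ⟨inner ℝ u (A u), hA u (ne_zero_of_mem_unit_sphere ⟨u, hu⟩), fun x => ?_⟩
  rcases eq_or_ne x 0 with rfl | hx
  · simp
  have hx' : 0 < ‖x‖ := norm_pos_iff.2 hx
  have h : inner ℝ u (A u) ≤ inner ℝ (‖x‖⁻¹ • x) (A (‖x‖⁻¹ • x)) :=
    hmin (by simp [norm_smul, hx'.ne'])
  rw [map_smul, inner_smul_left, inner_smul_right] at h
  have h' := mul_le_mul_of_nonneg_right h (sq_nonneg ‖x‖)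
  refine h'.trans_eq ?_
  simp only [map_inv₀, conj_trivial]
  field_simp

/-- For `T` symmetric positive definite and any `b`, the piecewise linear system
`x⁺ + Tx = b` has exactly one solution. -/
theorem stmt8 {n : ℕ} (T : Matrix (Fin n) (Fin n) ℝ) (b : Fin n → ℝ)
    (hsym : T.IsSymm) (hpd : T.PosDef) :
    ∃! x : Fin n → ℝ, vecPos x + T.mulVec x = b := by
  let A := Matrix.toEuclideanCLM (𝕜 := ℝ) T
  let P : EuclideanSpace ℝ (Fin n) → EuclideanSpace ℝ (Fin n) := fun x =>
    WithLp.toLp 2 (vecPos x.ofLp)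
  obtain ⟨c, hc, hcA⟩ := exists_pos_mul_norm_sq_le_inner A fun x hx => by
    have h := hpd.dotProduct_mulVec_pos (x := x.ofLp) (by simpa using hx)
    simpa [A, EuclideanSpace.inner_eq_star_dotProduct, dotProduct_comm] using h
  have hPmono : ∀ x y, 0 ≤ inner ℝ (x - y) (P x - P y) := fun x y => by
    rw [PiLp.inner_apply]
    refine Finset.sum_nonneg fun i _ => ?_
    simp only [P, vecPos, PiLp.sub_apply, RCLike.inner_apply, conj_trivial]
    rcases le_total (x i) (y i) with h | h
    · exact mul_nonneg_of_nonpos_of_nonpos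
        (sub_nonpos.2 (max_le_max_right 0 h)) (sub_nonpos.2 h)
    · exact mul_nonneg (sub_nonneg.2 (max_le_max_right 0 h)) (sub_nonneg.2 h)
  have hPlip : ∀ x y, ‖P x - P y‖ ≤ ‖x - y‖ := fun x y => by
    rw [EuclideanSpace.norm_eq, EuclideanSpace.norm_eq]
    refine Real.sqrt_le_sqrt (Finset.sum_le_sum fun i _ => ?_)
    exact pow_le_pow_left₀ (norm_nonneg _) (abs_max_sub_max_le_abs (x i) (y i) 0) 2
  have hmono : ∀ x y, c * ‖x - y‖ ^ 2 ≤ inner ℝ (x - y) ((P x + A x) - (P y + A y)) :=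
    fun x y => by
      rw [add_sub_add_comm, inner_add_right, ← map_sub]
      linarith [hcA (x - y), hPmono x y]
  have hlip : ∀ x y, ‖(P x + A x) - (P y + A y)‖ ≤ (1 + ‖A‖) * ‖x - y‖ := fun x y => by
    rw [add_sub_add_comm, ← map_sub, add_mul, one_mul]
    exact (norm_add_le _ _).trans (add_le_add (hPlip x y) (A.le_opNorm _))
  have hF : ∀ x : EuclideanSpace ℝ (Fin n),
      (P x + A x).ofLp = vecPos x.ofLp + T.mulVec x.ofLp := fun x => by
    simp [P, A]
  obtain ⟨x, hx⟩ := surjective_of_stronglyMonotone_of_lipschitz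
    (F := fun x => P x + A x) hc (by positivity) hmono hlip (WithLp.toLp 2 b)
  have hxb : vecPos x.ofLp + T.mulVec x.ofLp = b := by
    rw [← hF]
    exact congrArg WithLp.ofLp hx
  refine ⟨x.ofLp, hxb, fun y hy => ?_⟩
  have hxy : P (WithLp.toLp 2 y) + A (WithLp.toLp 2 y) = P x + A x :=
    WithLp.ofLp_injective 2 (by rw [hF, hF, hxb]; exact hy)
  have h := hmono (WithLp.toLp 2 y) x
  rw [hxy, sub_self, inner_zero_right] at h
  have h0 : ‖WithLp.toLp 2 y - x‖ = 0 := by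
    rw [← sq_eq_zero_iff]
    nlinarith [sq_nonneg ‖WithLp.toLp 2 y - x‖]
  exact congrArg WithLp.ofLp (sub_eq_zero.1 (norm_eq_zero.1 h0))
end

section
/- Let T be a symmetric positive definite n×n real matrix and b ∈ ℝⁿ, and define Φ : ℝⁿ → ℝⁿ by Φ(x) = (T + I)^{-1}(b − x⁻), where x⁻ is the vector with components x_i⁻ = max(−x_i, 0). Then (a) Φ(x) = x if and only if x⁺ + Tx = b, and (b) there exists λ ∈ [0, 1) such that ‖Φ(x) − Φ(y)‖₂ ≤ λ ‖x − y‖₂ for all x, y ∈ ℝⁿ, i.e., Φ is a contraction in the Euclidean norm. -/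
/-- The componentwise negative part `x⁻` of a vector, with `xᵢ⁻ = max(−xᵢ, 0)`. -/
noncomputable def vecNeg {n : ℕ} (x : Fin n → ℝ) : Fin n → ℝ := fun i => max (-x i) 0

/-- The Euclidean norm `‖v‖₂` of a vector in `ℝⁿ`. -/
noncomputable def euclNorm {n : ℕ} (v : Fin n → ℝ) : ℝ := Real.sqrt (∑ i, (v i) ^ 2)

open Matrix in
/-- A positive definite real matrix is coercive. -/
theorem posDef_exists_coercive {n : ℕ} {T : Matrix (Fin n) (Fin n) ℝ} (hT : T.PosDef) :
    ∃ c : ℝ, 0 < c ∧ ∀ v : Fin n → ℝ, c * (v ⬝ᵥ v) ≤ v ⬝ᵥ T *ᵥ v := by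
  have hself : ∀ v : Fin n → ℝ, v ≠ 0 → 0 < v ⬝ᵥ v := fun v hv => by
    simpa using Matrix.dotProduct_star_self_pos_iff.2 hv
  have hpos : ∀ v : Fin n → ℝ, v ≠ 0 → 0 < v ⬝ᵥ T *ᵥ v := fun v hv => by
    simpa using hT.dotProduct_mulVec_pos hv
  have hne : ∀ v ∈ Metric.sphere (0 : Fin n → ℝ) 1, v ≠ 0 := fun v hv =>
    ne_zero_of_mem_unit_sphere ⟨v, hv⟩
  have hcont : ContinuousOn (fun v : Fin n → ℝ => (v ⬝ᵥ T *ᵥ v) / (v ⬝ᵥ v))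
      (Metric.sphere 0 1) := by
    refine ContinuousOn.div ?_ ?_ fun v hv => (hself v (hne v hv)).ne'
    · exact (continuous_id.dotProduct (continuous_const.matrix_mulVec continuous_id)).continuousOn
    · exact (continuous_id.dotProduct continuous_id).continuousOn
  obtain ⟨c, hc, hle⟩ := (isCompact_sphere (0 : Fin n → ℝ) 1).exists_forall_le' hcont
    (a := 0) fun v hv => div_pos (hpos v (hne v hv)) (hself v (hne v hv))
  refine ⟨c, hc, fun v => ?_⟩
  rcases eq_or_ne v 0 with rfl | hv
  · simp
  have hn : 0 < ‖v‖ := norm_pos_iff.2 hv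
  have hmem : ‖v‖⁻¹ • v ∈ Metric.sphere (0 : Fin n → ℝ) 1 := by
    simp [norm_smul, hn.ne']
  have h := (le_div_iff₀ (hself _ (hne _ hmem))).1 (hle _ hmem)
  simp only [mulVec_smul, smul_dotProduct, dotProduct_smul, smul_eq_mul] at h
  have hi : 0 < ‖v‖⁻¹ * ‖v‖⁻¹ := by positivity
  refine le_of_mul_le_mul_left ?_ hi
  linarith

theorem euclNorm_vecNeg_sub_le {n : ℕ} (x y : Fin n → ℝ) :
    euclNorm (vecNeg x - vecNeg y) ≤ euclNorm (x - y) := by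
  refine Real.sqrt_le_sqrt (Finset.sum_le_sum fun i _ => sq_le_sq.2 ?_)
  calc |max (-x i) 0 - max (-y i) 0| ≤ |-x i - -y i| := abs_max_sub_max_le_abs _ _ _
    _ = |x i - y i| := by rw [neg_sub_neg, abs_sub_comm]

open Matrix in
theorem euclNorm_le_of_mul_dotProduct_le {n : ℕ} {u w : Fin n → ℝ} {a : ℝ} (ha : 0 < a)
    (h : a * (u ⬝ᵥ u) ≤ u ⬝ᵥ w) : euclNorm u ≤ a⁻¹ * euclNorm w := by
  have hcs : u ⬝ᵥ w ≤ euclNorm u * euclNorm w :=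
    Real.sum_mul_le_sqrt_mul_sqrt Finset.univ u w
  have hu : u ⬝ᵥ u = euclNorm u * euclNorm u := by
    rw [euclNorm, Real.mul_self_sqrt (Finset.sum_nonneg fun i _ => sq_nonneg _)]
    simp only [dotProduct, sq]
  have hu0 : 0 ≤ euclNorm u := Real.sqrt_nonneg _
  have hw0 : 0 ≤ euclNorm w := Real.sqrt_nonneg _
  rcases hu0.eq_or_lt with h0 | h0
  · rw [← h0]
    positivity
  rw [le_inv_mul_iff₀ ha]
  refine le_of_mul_le_mul_left ?_ h0
  rw [hu] at h
  linarith

theorem vecPos_sub_vecNeg {n : ℕ} (x : Fin n → ℝ) : vecPos x - vecNeg x = x := by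
  funext i
  simp only [vecPos, vecNeg, Pi.sub_apply]
  rcases le_total (x i) 0 with h | h <;> simp [h]

/-- For `T` symmetric positive definite, the map `Φ(x) = (T + I)⁻¹(b − x⁻)` has as fixed
points exactly the solutions of `x⁺ + Tx = b`, and `Φ` is a contraction in the Euclidean
norm: there is `λ ∈ [0,1)` with `‖Φ(x) − Φ(y)‖₂ ≤ λ‖x − y‖₂` for all `x, y`. -/
theorem stmt9 {n : ℕ} (T : Matrix (Fin n) (Fin n) ℝ) (b : Fin n → ℝ)
    (hsym : T.IsSymm) (hpd : T.PosDef)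
    (Φ : (Fin n → ℝ) → (Fin n → ℝ))
    (hΦ : ∀ x, Φ x = (T + 1)⁻¹.mulVec (b - vecNeg x)) :
    (∀ x : Fin n → ℝ, Φ x = x ↔ vecPos x + T.mulVec x = b) ∧
    ∃ lam : ℝ, 0 ≤ lam ∧ lam < 1 ∧
      ∀ x y : Fin n → ℝ, euclNorm (Φ x - Φ y) ≤ lam * euclNorm (x - y) := by
  have hdet : IsUnit (T + 1).det :=
    (Matrix.isUnit_iff_isUnit_det _).1 (hpd.add Matrix.PosDef.one).isUnit
  have hinv : ∀ v : Fin n → ℝ, (T + 1).mulVec ((T + 1)⁻¹.mulVec v) = v := fun v => by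
    rw [Matrix.mulVec_mulVec, Matrix.mul_nonsing_inv _ hdet, Matrix.one_mulVec]
  have hinv' : ∀ v : Fin n → ℝ, (T + 1)⁻¹.mulVec ((T + 1).mulVec v) = v := fun v => by
    rw [Matrix.mulVec_mulVec, Matrix.nonsing_inv_mul _ hdet, Matrix.one_mulVec]
  refine ⟨fun x => ?_, ?_⟩
  · have hx : (T + 1).mulVec x = vecPos x + T.mulVec x - vecNeg x := by
      rw [Matrix.add_mulVec, Matrix.one_mulVec, add_comm (vecPos x), add_sub_assoc,
        vecPos_sub_vecNeg]
    rw [hΦ]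
    constructor
    · intro h
      have h' := hinv (b - vecNeg x)
      rw [h, hx] at h'
      exact sub_left_injective h'
    · intro h
      rw [← h, ← hx, hinv']
  · obtain ⟨c, hc, hcoer⟩ := posDef_exists_coercive hpd
    have hc1 : 0 < 1 + c := by linarith
    refine ⟨(1 + c)⁻¹, by positivity, inv_lt_one_of_one_lt₀ (by linarith), fun x y => ?_⟩
    have hdiff : (T + 1).mulVec (Φ x - Φ y) = vecNeg y - vecNeg x := by
      rw [Matrix.mulVec_sub, hΦ, hΦ, hinv, hinv, sub_sub_sub_cancel_left]
    have hle : euclNorm (Φ x - Φ y) ≤ (1 + c)⁻¹ * euclNorm (vecNeg y - vecNeg x) := by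
      refine euclNorm_le_of_mul_dotProduct_le hc1 ?_
      rw [← hdiff, Matrix.add_mulVec, Matrix.one_mulVec, dotProduct_add]
      linarith [hcoer (Φ x - Φ y)]
    have hsymm : euclNorm (y - x) = euclNorm (x - y) := by
      simp only [euclNorm, Pi.sub_apply, sub_sq_comm]
    rw [← hsymm]
    exact hle.trans (mul_le_mul_of_nonneg_left (euclNorm_vecNeg_sub_le y x) (by positivity))
end

section
/- Let T be a symmetric positive definite n×n real matrix and b ∈ ℝⁿ. If x, y ∈ ℝⁿ satisfy (P(x) + T) y = b and (P(y) + T) x = b, then x = y. In other words, the semi-smooth Newton iteration cannot cycle between two distinct points. -/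
/-- For `T` symmetric positive definite, the semi-smooth Newton iteration cannot cycle
between two points: if `(P(x) + T) y = b` and `(P(y) + T) x = b`, then `x = y`. -/
theorem stmt10 {n : ℕ} (T : Matrix (Fin n) (Fin n) ℝ) (b x y : Fin n → ℝ)
    (hsym : T.IsSymm) (hpd : T.PosDef)
    (hxy : (Pmat x + T).mulVec y = b)
    (hyx : (Pmat y + T).mulVec x = b) :
    x = y := by
  by_contra hne
  have hpos := hpd.dotProduct_mulVec_pos (sub_ne_zero.mpr hne)
  refine absurd hpos (not_lt.mpr (Finset.sum_nonpos fun i _ => ?_))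
  have hi := congrFun (hxy.trans hyx.symm) i
  simp only [Pmat, Matrix.add_mulVec, Pi.add_apply, Matrix.mulVec_diagonal] at hi
  simp only [Matrix.mulVec_sub, star_trivial, Pi.sub_apply]
  have hT : T.mulVec x i - T.mulVec y i =
      (if 0 < x i then 1 else 0) * y i - (if 0 < y i then 1 else 0) * x i := by
    linarith
  rw [hT]
  split_ifs <;> nlinarith [sq_nonneg (x i - y i)]
end

section
/- Let T be a symmetric positive definite 2×2 real matrix, b ∈ ℝ², and let (x^k)_{k∈ℕ} be any sequence in ℝ² satisfying the semi-smooth Newton recurrence (P(x^k) + T) x^{k+1} = b for all k. Then the iteration converges in finitely many steps: there exists K ∈ ℕ such that for all k ≥ K, (x^k)⁺ + T x^k = b (and the x^k for k ≥ K all equal the unique solution of the system). -/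
/-- If the truth of `d < (a + t) * c` differs for `t = 0` and `t = 1`, then `|a * c| ≤ |d|`. -/
lemma sq_le_sq_of_not_lt_iff {a c d : ℝ} (ha : 0 < a)
    (h : ¬(d < a * c ↔ d < (a + 1) * c)) : 0 < c ^ 2 ∧ (a * c) ^ 2 ≤ d ^ 2 := by
  have hc : (0 < c ∧ a * c ≤ d) ∨ (c < 0 ∧ d < a * c) := by
    by_cases h1 : d < a * c
    · have h2 : ¬ d < (a + 1) * c := fun h2 => h ⟨fun _ => h2, fun _ => h1⟩
      exact .inr ⟨by linarith, h1⟩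
    · have h2 : d < (a + 1) * c := by
        by_contra h2
        exact h ⟨fun h3 => absurd h3 h1, fun h3 => absurd h3 h2⟩
      exact .inl ⟨by linarith, not_lt.mp h1⟩
  rcases hc with ⟨hc, hd⟩ | ⟨hc, hd⟩
  · have := mul_pos ha hc
    exact ⟨by positivity, by nlinarith⟩
  · have := mul_neg_of_pos_of_neg ha hc
    exact ⟨by nlinarith, by nlinarith⟩

/-- For positive definite `!![p, q; q, r]`, at least one of the two signs of a Newton step does
not depend on the previous sign pattern. -/
lemma lt_iff_or_lt_iff {p q r u v : ℝ} (hp : 0 < p) (hr : 0 < r) (hdet : q ^ 2 < p * r) :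
    (q * v < r * u ↔ q * v < (r + 1) * u) ∨ (q * u < p * v ↔ q * u < (p + 1) * v) := by
  by_contra h
  rw [not_or] at h
  obtain ⟨hu, h1⟩ := sq_le_sq_of_not_lt_iff hr h.1
  obtain ⟨hv, h2⟩ := sq_le_sq_of_not_lt_iff hp h.2
  have h3 := mul_le_mul h1 h2 (sq_nonneg _) (sq_nonneg _)
  have h4 : (q ^ 2) ^ 2 < (p * r) ^ 2 := pow_lt_pow_left₀ hdet (sq_nonneg q) two_ne_zero
  nlinarith [mul_lt_mul_of_pos_right h4 (mul_pos hu hv)]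

/-- The sign of the first unknown of a `2 × 2` system with positive determinant. -/
lemma pos_iff_of_linear_system {α β q u v y z : ℝ} (hD : q ^ 2 < α * β)
    (h1 : α * y + q * z = u) (h2 : q * y + β * z = v) : 0 < y ↔ q * v < β * u := by
  have h : β * u - q * v = (α * β - q ^ 2) * y := by rw [← h1, ← h2]; ring
  rw [← sub_pos (b := q * v), h, mul_pos_iff_of_pos_left (sub_pos.mpr hD)]

/-- A `2 × 2` system with positive determinant has at most one solution. -/
lemma eq_of_linear_system {α β q u v y z y' z' : ℝ} (hD : q ^ 2 < α * β)
    (h1 : α * y + q * z = u) (h2 : q * y + β * z = v)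
    (h1' : α * y' + q * z' = u) (h2' : q * y' + β * z' = v) : y = y' ∧ z = z' := by
  have hD' : α * β - q ^ 2 ≠ 0 := (sub_pos.mpr hD).ne'
  constructor <;> apply mul_left_cancel₀ hD'
  · linear_combination β * h1 - q * h2 - β * h1' + q * h2'
  · linear_combination α * h2 - q * h1 - α * h2' + q * h1'

lemma max_zero_eq_ite_mul (t : ℝ) : max t 0 = (if 0 < t then 1 else 0) * t := by
  split_ifs with h
  · simp [h.le]
  · simp [not_lt.mp h]

/-- Finite convergence for `n = 2`: if `T` is a symmetric positive definite `2 × 2`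
matrix and `(xᵏ)` satisfies the semi-smooth Newton recurrence `(P(xᵏ) + T) xᵏ⁺¹ = b`,
then after finitely many steps all iterates solve `x⁺ + Tx = b` (and coincide with the
unique solution, in particular they are all equal from that point on). -/
theorem stmt11 (T : Matrix (Fin 2) (Fin 2) ℝ) (b : Fin 2 → ℝ)
    (hsym : T.IsSymm) (hpd : T.PosDef)
    (x : ℕ → Fin 2 → ℝ)
    (hrec : ∀ k : ℕ, (Pmat (x k) + T).mulVec (x (k + 1)) = b) :
    ∃ K : ℕ, ∀ k, K ≤ k →
      (vecPos (x k) + T.mulVec (x k) = b ∧ ∀ m, K ≤ m → x k = x m) := by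
  have hp : 0 < T 0 0 := hpd.diag_pos
  have hr : 0 < T 1 1 := hpd.diag_pos
  have h10 : T 1 0 = T 0 1 := hsym.apply 0 1
  have hdet : T 0 1 ^ 2 < T 0 0 * T 1 1 := by
    have := hpd.det_pos
    rw [Matrix.det_fin_two, h10] at this
    nlinarith
  set p := T 0 0
  set q := T 0 1
  set r := T 1 1
  let s : ℝ → ℝ := fun t => if 0 < t then 1 else 0
  have hs : ∀ t, 0 ≤ s t := fun t => by dsimp only [s]; split_ifs <;> norm_num
  have hD : ∀ t t', q ^ 2 < (p + s t) * (r + s t') := fun t t' => by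
    nlinarith [hs t, hs t', mul_nonneg (hs t) (hs t'), mul_nonneg hp.le (hs t'),
      mul_nonneg hr.le (hs t)]
  have e0 : ∀ k, (p + s (x k 0)) * x (k + 1) 0 + q * x (k + 1) 1 = b 0 := fun k => by
    have := congrFun (hrec k) 0
    simp [Matrix.mulVec, dotProduct, Fin.sum_univ_two, Pmat] at this
    simp only [p, q, s]
    linarith
  have e1 : ∀ k, q * x (k + 1) 0 + (r + s (x k 1)) * x (k + 1) 1 = b 1 := fun k => by
    have := congrFun (hrec k) 1
    simp [Matrix.mulVec, dotProduct, Fin.sum_univ_two, Pmat, h10] at this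
    simp only [q, r, s]
    linarith
  have hA : ∀ k, 0 < x (k + 1) 0 ↔ q * b 1 < (r + s (x k 1)) * b 0 := fun k =>
    pos_iff_of_linear_system (hD _ _) (e0 k) (e1 k)
  have hB : ∀ k, 0 < x (k + 1) 1 ↔ q * b 0 < (p + s (x k 0)) * b 1 := fun k =>
    pos_iff_of_linear_system (by rw [mul_comm]; exact hD _ _)
      ((add_comm _ _).trans (e1 k)) ((add_comm _ _).trans (e0 k))
  have s_congr : ∀ {t t' : ℝ}, (0 < t ↔ 0 < t') → s t = s t' := fun h => by
    simp only [s, h]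
  have hconst : ∀ k, s (x (k + 2) 0) = s (x 2 0) ∧ s (x (k + 2) 1) = s (x 2 1) := by
    rcases lt_iff_or_lt_iff (u := b 0) (v := b 1) hp hr hdet with h | h
    · have hA' : ∀ k, 0 < x (k + 1) 0 ↔ q * b 1 < r * b 0 := fun k => by
        rw [hA]
        by_cases hk : 0 < x k 1 <;> simp [s, hk, h]
      have hA'' : ∀ k, s (x (k + 1) 0) = s (x 1 0) := fun k =>
        s_congr ((hA' k).trans (hA' 0).symm)
      refine fun k => ⟨(hA'' (k + 1)).trans (hA'' 1).symm, s_congr ?_⟩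
      rw [hB (k + 1), hB 1, hA'' k]
    · have hB' : ∀ k, 0 < x (k + 1) 1 ↔ q * b 0 < p * b 1 := fun k => by
        rw [hB]
        by_cases hk : 0 < x k 0 <;> simp [s, hk, h]
      have hB'' : ∀ k, s (x (k + 1) 1) = s (x 1 1) := fun k =>
        s_congr ((hB' k).trans (hB' 0).symm)
      refine fun k => ⟨s_congr ?_, (hB'' (k + 1)).trans (hB'' 1).symm⟩
      rw [hA (k + 1), hA 1, hB'' k]
  have heq : ∀ k, x (k + 3) = x 3 := fun k => by
    have h0 := e0 (k + 2)
    have h1 := e1 (k + 2)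
    rw [(hconst k).1] at h0
    rw [(hconst k).2] at h1
    have := eq_of_linear_system (hD _ _) h0 h1 (e0 2) (e1 2)
    ext i
    fin_cases i
    exacts [this.1, this.2]
  have hsol : vecPos (x 3) + T.mulVec (x 3) = b := by
    have h := hrec 3
    rw [heq 1, Matrix.add_mulVec] at h
    rw [← h]
    congr 1
    ext i
    simp only [vecPos, Pmat, Matrix.mulVec_diagonal, max_zero_eq_ite_mul]
  have heq' : ∀ k, 3 ≤ k → x k = x 3 := fun k hk => by
    obtain ⟨j, rfl⟩ := Nat.exists_eq_add_of_le' hk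
    exact heq j
  refine ⟨3, fun k hk => ⟨?_, fun m hm => (heq' k hk).trans (heq' m hm).symm⟩⟩
  rw [heq' k hk]
  exact hsol
end

section
/- Let b ∈ ℝⁿ and let T = (t_ij) be an n×n real matrix satisfying the strong Sassenfeld condition (β = max_i β_i < 1). Then the piecewise linear system x⁺ + Tx = b has exactly one solution x ∈ ℝⁿ. -/
/-- If `T` is strictly diagonally dominant with margin after scaling its columns by a positive
vector `w`, then `x⁺ + Tx = b` has exactly one solution: in the scaled variable the Jacobi
iteration is a contraction for the sup norm. -/
theorem existsUnique_vecPos_add_mulVec_of_scaled_dominant {n : ℕ}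
    (T : Matrix (Fin n) (Fin n) ℝ) (b w : Fin n → ℝ) (hw : ∀ i, 0 < w i)
    (hdom : ∀ i, w i + ∑ j ∈ Finset.univ.erase i, |T i j| * w j < |T i i| * w i) :
    ∃! x : Fin n → ℝ, vecPos x + T.mulVec x = b := by
  have hnonneg : ∀ i, 0 ≤ w i + ∑ j ∈ Finset.univ.erase i, |T i j| * w j := fun i =>
    add_nonneg (hw i).le (Finset.sum_nonneg fun j _ => mul_nonneg (abs_nonneg _) (hw j).le)
  have hpos : ∀ i, 0 < |T i i| * w i := fun i => (hnonneg i).trans_lt (hdom i)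
  have hT : ∀ i, T i i ≠ 0 := fun i h => by simpa [h] using hpos i
  obtain ⟨K, hK, hq⟩ : ∃ K : NNReal, K < 1 ∧
      ∀ i, w i + ∑ j ∈ Finset.univ.erase i, |T i j| * w j ≤ K * (|T i i| * w i) := by
    refine ⟨Finset.univ.sup fun i => Real.toNNReal
      ((w i + ∑ j ∈ Finset.univ.erase i, |T i j| * w j) / (|T i i| * w i)), ?_, fun i => ?_⟩
    · rw [Finset.sup_lt_iff (by simp)]
      intro i _
      rw [Real.toNNReal_lt_one, div_lt_one (hpos i)]
      exact hdom i
    · rw [← div_le_iff₀ (hpos i), ← Real.toNNReal_le_iff_le_coe]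
      exact Finset.le_sup (f := fun i => Real.toNNReal
        ((w i + ∑ j ∈ Finset.univ.erase i, |T i j| * w j) / (|T i i| * w i))) (Finset.mem_univ i)
  let F : (Fin n → ℝ) → Fin n → ℝ := fun y i =>
    (b i - max (w i * y i) 0 - ∑ j ∈ Finset.univ.erase i, T i j * (w j * y j)) / (T i i * w i)
  have hF : ContractingWith K F := by
    refine ⟨hK, LipschitzWith.of_dist_le_mul fun y z => ?_⟩
    rw [dist_pi_le_iff (by positivity)]
    intro i
    have hcoord : ∀ j, |w j * y j - w j * z j| ≤ w j * dist y z := fun j => by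
      rw [← mul_sub, abs_mul, abs_of_pos (hw j)]
      exact mul_le_mul_of_nonneg_left (dist_le_pi_dist y z j) (hw j).le
    have hmax : |max (w i * z i) 0 - max (w i * y i) 0| ≤ w i * dist y z := by
      rw [abs_sub_comm]
      exact (abs_max_sub_max_le_abs _ _ _).trans (hcoord i)
    have hsum : |∑ j ∈ Finset.univ.erase i, (T i j * (w j * z j) - T i j * (w j * y j))| ≤
        (∑ j ∈ Finset.univ.erase i, |T i j| * w j) * dist y z := by
      rw [Finset.sum_mul]
      refine (Finset.abs_sum_le_sum_abs _ _).trans (Finset.sum_le_sum fun j _ => ?_)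
      rw [← mul_sub, abs_mul, abs_sub_comm, mul_assoc]
      exact mul_le_mul_of_nonneg_left (hcoord j) (abs_nonneg _)
    have hnum : F y i - F z i = ((max (w i * z i) 0 - max (w i * y i) 0) +
        ∑ j ∈ Finset.univ.erase i, (T i j * (w j * z j) - T i j * (w j * y j))) /
          (T i i * w i) := by
      simp only [F, Finset.sum_sub_distrib]
      ring
    rw [Real.dist_eq, hnum, abs_div, abs_mul, abs_of_pos (hw i), div_le_iff₀ (hpos i)]
    calc _ ≤ w i * dist y z + (∑ j ∈ Finset.univ.erase i, |T i j| * w j) * dist y z :=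
          (abs_add_le _ _).trans (add_le_add hmax hsum)
      _ = (w i + ∑ j ∈ Finset.univ.erase i, |T i j| * w j) * dist y z := by ring
      _ ≤ K * (|T i i| * w i) * dist y z := mul_le_mul_of_nonneg_right (hq i) dist_nonneg
      _ = K * dist y z * (|T i i| * w i) := by ring
  have hfix : ∀ y : Fin n → ℝ, F y = y ↔ vecPos (w * y) + T.mulVec (w * y) = b := by
    intro y
    rw [funext_iff, funext_iff]
    refine forall_congr' fun i => ?_
    have hrow : T.mulVec (w * y) i =
        T i i * (w i * y i) + ∑ j ∈ Finset.univ.erase i, T i j * (w j * y j) :=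
      (Finset.add_sum_erase _ (fun j => T i j * (w j * y j)) (Finset.mem_univ i)).symm
    rw [Pi.add_apply, hrow, div_eq_iff (mul_ne_zero (hT i) (hw i).ne')]
    simp only [vecPos, Pi.mul_apply]
    constructor <;> intro h <;> linarith
  refine ⟨w * hF.fixedPoint F, (hfix _).1 hF.fixedPoint_isFixedPt, fun x hx => ?_⟩
  have hscale : w * (x / w) = x := by
    ext i
    exact mul_div_cancel₀ (x i) (hw i).ne'
  have hxfix : F (x / w) = x / w := (hfix _).2 (by rwa [hscale])
  rw [← hF.fixedPoint_unique hxfix, hscale]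

/-- Existence and uniqueness under the strong Sassenfeld condition: if the Sassenfeld
quantities `βᵢ = (Σ_{j<i} |tᵢⱼ| βⱼ + Σ_{j>i} |tᵢⱼ| + 1)/|tᵢᵢ|` all satisfy `βᵢ < 1`,
then the piecewise linear system `x⁺ + Tx = b` has exactly one solution. -/
theorem stmt14 {n : ℕ} (T : Matrix (Fin n) (Fin n) ℝ) (b : Fin n → ℝ)
    (hdiag : ∀ i, T i i ≠ 0)
    (β : Fin n → ℝ)
    (hβ : ∀ i, β i =
      ((∑ j ∈ Finset.univ.filter (fun j => j < i), |T i j| * β j) +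
        (∑ j ∈ Finset.univ.filter (fun j => i < j), |T i j|) + 1) / |T i i|)
    (hβlt : ∀ i, β i < 1) :
    ∃! x : Fin n → ℝ, vecPos x + T.mulVec x = b := by
  have hβ0 : ∀ i, 0 < β i := by
    intro i
    induction i using WellFoundedLT.induction with
    | ind i ih =>
      rw [hβ i]
      have hlow : 0 ≤ ∑ j ∈ Finset.univ.filter (fun j => j < i), |T i j| * β j :=
        Finset.sum_nonneg fun j hj =>
          mul_nonneg (abs_nonneg _) (ih j (Finset.mem_filter.1 hj).2).le
      have hdiag_pos := abs_pos.2 (hdiag i)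
      positivity
  refine existsUnique_vecPos_add_mulVec_of_scaled_dominant T b β hβ0 fun i => ?_
  have hrow := (eq_div_iff (abs_pos.2 (hdiag i)).ne').1 (hβ i)
  have hupper : ∑ j ∈ Finset.univ.filter (fun j => i < j), |T i j| * β j ≤
      ∑ j ∈ Finset.univ.filter (fun j => i < j), |T i j| :=
    Finset.sum_le_sum fun j _ => mul_le_of_le_one_right (abs_nonneg _) (hβlt j).le
  have hsplit : ∑ j ∈ Finset.univ.erase i, |T i j| * β j =
      ∑ j ∈ Finset.univ.filter (fun j => j < i), |T i j| * β j +
        ∑ j ∈ Finset.univ.filter (fun j => i < j), |T i j| * β j := by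
    rw [← Finset.sum_union (Finset.disjoint_filter.2 fun j _ h => h.asymm)]
    congr 1
    ext j
    simp
  linarith [hβlt i]
end

section
/- Let T = (1/100)·[[−26, 16], [23, −33]] and b = (1/100)·(−12, 12)ᵀ. Then T is diagonally dominant (|t_ii| ≥ Σ_{j≠i} |t_ij| for each i), yet there is no x ∈ ℝ² with x⁺ + Tx = b. Hence diagonal dominance of T does not guarantee existence of solutions of the piecewise linear system. -/
/-- Diagonal dominance is not sufficient for existence of solutions: the matrix
`T = (1/100)·[[−26, 16], [23, −33]]` is diagonally dominant, yet the system
`x⁺ + Tx = b` with `b = (1/100)·(−12, 12)ᵀ` has no solution. -/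
theorem stmt15 :
    let T : Matrix (Fin 2) (Fin 2) ℝ := (1 / 100 : ℝ) • !![-26, 16; 23, -33]
    let b : Fin 2 → ℝ := ![-12 / 100, 12 / 100]
    (∀ i, ∑ j ∈ Finset.univ.filter (fun j => j ≠ i), |T i j| ≤ |T i i|) ∧
      ¬ ∃ x : Fin 2 → ℝ, vecPos x + T.mulVec x = b := by
  intro T b
  refine ⟨fun i => ?_, ?_⟩
  · fin_cases i <;> norm_num [T, Finset.sum_filter, Fin.sum_univ_two, abs_of_pos, abs_of_neg]
  · rintro ⟨x, hx⟩
    have h0 := congrFun hx 0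
    have h1 := congrFun hx 1
    simp [T, b, vecPos, dotProduct, Fin.sum_univ_two] at h0 h1
    rcases max_cases (x 0) 0 with ⟨e0, _⟩ | ⟨e0, _⟩ <;>
      rcases max_cases (x 1) 0 with ⟨e1, _⟩ | ⟨e1, _⟩ <;>
      rw [e0] at h0 <;> rw [e1] at h1 <;> linarith
end

section
/- Let T be an n×n real matrix with decomposition T = L + D + U, where D is the diagonal part of T and L, U are its strictly lower and strictly upper triangular parts, and let b ∈ ℝⁿ. Suppose (x^k)_{k∈ℕ} is a sequence in ℝⁿ satisfying the Jacobi-Newton recurrence (P(x^k) + D) x^{k+1} = −(L + U) x^k + b for all k, and x^k converges to x̄ ∈ ℝⁿ. Then x̄ solves the piecewise linear system: x̄⁺ + T x̄ = b. -/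
/-- The diagonal part `D` of a matrix `T`. -/
def Dpart {n : ℕ} (T : Matrix (Fin n) (Fin n) ℝ) : Matrix (Fin n) (Fin n) ℝ :=
  Matrix.diagonal fun i => T i i

/-- The strictly lower triangular part `L` of a matrix `T`. -/
def Lpart {n : ℕ} (T : Matrix (Fin n) (Fin n) ℝ) : Matrix (Fin n) (Fin n) ℝ :=
  Matrix.of fun i j => if j < i then T i j else 0

/-- The strictly upper triangular part `U` of a matrix `T`. -/
def Upart {n : ℕ} (T : Matrix (Fin n) (Fin n) ℝ) : Matrix (Fin n) (Fin n) ℝ :=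
  Matrix.of fun i j => if i < j then T i j else 0

open Filter Topology in
/-- If `y` converges to `a`, then switching `y (k + 1)` on exactly when `y k` is positive
gives a sequence converging to the positive part of `a`. -/
theorem tendsto_ite_pos_mul_succ {y : ℕ → ℝ} {a : ℝ} (hy : Tendsto y atTop (𝓝 a)) :
    Tendsto (fun k => (if 0 < y k then 1 else 0) * y (k + 1)) atTop (𝓝 (max a 0)) := by
  have hdiff : Tendsto (fun k => |y (k + 1) - y k|) atTop (𝓝 0) := by
    simpa using ((hy.comp (tendsto_add_atTop_nat 1)).sub hy).abs
  have herr : Tendsto (fun k => (if 0 < y k then 1 else 0) * y (k + 1) - max (y k) 0)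
      atTop (𝓝 0) := by
    refine squeeze_zero_norm (fun k => ?_) hdiff
    rw [Real.norm_eq_abs]
    split_ifs with h
    · rw [max_eq_left h.le, one_mul]
    · rw [max_eq_right (not_lt.mp h), zero_mul, sub_zero, abs_zero]
      exact abs_nonneg _
  simpa using herr.add (hy.max (tendsto_const_nhds (x := (0 : ℝ))))

theorem Dpart_add_Lpart_add_Upart {n : ℕ} (T : Matrix (Fin n) (Fin n) ℝ) :
    Dpart T + (Lpart T + Upart T) = T := by
  ext i j
  rcases lt_trichotomy i j with h | rfl | h
  · simp [Dpart, Lpart, Upart, h, h.ne, h.not_gt]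
  · simp [Dpart, Lpart, Upart]
  · simp [Dpart, Lpart, Upart, h, h.ne', h.not_gt]

open Filter Topology in
theorem tendsto_Pmat_mulVec_succ {n : ℕ} {x : ℕ → Fin n → ℝ} {xbar : Fin n → ℝ}
    (hx : Tendsto x atTop (𝓝 xbar)) :
    Tendsto (fun k => (Pmat (x k)).mulVec (x (k + 1))) atTop (𝓝 (vecPos xbar)) := by
  refine tendsto_pi_nhds.mpr fun i => ?_
  simp only [Pmat, Matrix.mulVec_diagonal]
  exact tendsto_ite_pos_mul_succ (tendsto_pi_nhds.mp hx i)

/-- Limit points of the Jacobi-Newton iteration are solutions: if `(xᵏ)` satisfies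
`(P(xᵏ) + D) xᵏ⁺¹ = −(L + U) xᵏ + b` and `xᵏ → x̄`, then `x̄⁺ + T x̄ = b`. -/
theorem stmt16 {n : ℕ} (T : Matrix (Fin n) (Fin n) ℝ) (b : Fin n → ℝ)
    (x : ℕ → Fin n → ℝ) (xbar : Fin n → ℝ)
    (hrec : ∀ k : ℕ, (Pmat (x k) + Dpart T).mulVec (x (k + 1)) =
      -((Lpart T + Upart T).mulVec (x k)) + b)
    (hconv : Filter.Tendsto x Filter.atTop (nhds xbar)) :
    vecPos xbar + T.mulVec xbar = b := by
  have htend (A : Matrix (Fin n) (Fin n) ℝ) :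
      Filter.Tendsto A.mulVec (nhds xbar) (nhds (A.mulVec xbar)) :=
    (continuous_const.matrix_mulVec continuous_id).tendsto xbar
  have hlim := ((tendsto_Pmat_mulVec_succ hconv).add
    ((htend (Dpart T)).comp (hconv.comp (Filter.tendsto_add_atTop_nat 1)))).add
    ((htend (Lpart T + Upart T)).comp hconv)
  rw [add_assoc, ← Matrix.add_mulVec, Dpart_add_Lpart_add_Upart] at hlim
  refine tendsto_nhds_unique hlim (tendsto_const_nhds.congr fun k => ?_)
  simp only [Function.comp_apply]
  rw [← Matrix.add_mulVec, hrec]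
  abel
end

section
/- Let T be an n×n real matrix with decomposition T = L + D + U, where D is the diagonal part of T and L, U are its strictly lower and strictly upper triangular parts, and let b ∈ ℝⁿ. Suppose (x^k)_{k∈ℕ} is a sequence in ℝⁿ satisfying the Gauss-Seidel-Newton recurrence (P(x^k) + D + L) x^{k+1} = −U x^k + b for all k, and x^k converges to x̄ ∈ ℝⁿ. Then x̄ solves the piecewise linear system: x̄⁺ + T x̄ = b. -/
theorem Lpart_add_Dpart_add_Upart {n : ℕ} (T : Matrix (Fin n) (Fin n) ℝ) :
    Lpart T + Dpart T + Upart T = T := by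
  ext i j
  rcases lt_trichotomy i j with h | rfl | h
  · simp [Lpart, Dpart, Upart, h, h.not_gt, h.ne]
  · simp [Lpart, Dpart, Upart]
  · simp [Lpart, Dpart, Upart, h, h.not_gt, h.ne']

theorem abs_ite_pos_mul_sub_max_le (a b : ℝ) :
    |(if 0 < a then 1 else 0) * b - max a 0| ≤ |b - a| := by
  split_ifs with h
  · simp [max_eq_left h.le]
  · simp [max_eq_right (not_lt.mp h)]

theorem tendsto_Pmat_mulVec {ι : Type*} {l : Filter ι} {n : ℕ} {x y : ι → Fin n → ℝ}
    {z : Fin n → ℝ} (hx : Filter.Tendsto x l (nhds z)) (hy : Filter.Tendsto y l (nhds z)) :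
    Filter.Tendsto (fun k => (Pmat (x k)).mulVec (y k)) l (nhds (vecPos z)) := by
  rw [tendsto_pi_nhds] at hx hy ⊢
  intro i
  have hdiff : Filter.Tendsto (fun k => |y k i - x k i|) l (nhds 0) := by
    simpa using ((hy i).sub (hx i)).abs
  have herr : Filter.Tendsto
      (fun k => (if 0 < x k i then 1 else 0) * y k i - max (x k i) 0) l (nhds 0) :=
    squeeze_zero_norm (fun k => abs_ite_pos_mul_sub_max_le (x k i) (y k i)) hdiff
  have hmax : Filter.Tendsto (fun k => max (x k i) 0) l (nhds (max (z i) 0)) :=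
    (hx i).max tendsto_const_nhds
  simpa [Pmat, vecPos, Matrix.mulVec_diagonal] using herr.add hmax

theorem tendsto_matrix_mulVec {ι : Type*} {l : Filter ι} {n : ℕ} (A : Matrix (Fin n) (Fin n) ℝ)
    {x : ι → Fin n → ℝ} {z : Fin n → ℝ} (hx : Filter.Tendsto x l (nhds z)) :
    Filter.Tendsto (fun k => A.mulVec (x k)) l (nhds (A.mulVec z)) :=
  ((continuous_const.matrix_mulVec continuous_id).tendsto z).comp hx

/-- Limit points of the Gauss-Seidel-Newton iteration are solutions: if `(xᵏ)` satisfies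
`(P(xᵏ) + D + L) xᵏ⁺¹ = −U xᵏ + b` and `xᵏ → x̄`, then `x̄⁺ + T x̄ = b`. -/
theorem stmt18 {n : ℕ} (T : Matrix (Fin n) (Fin n) ℝ) (b : Fin n → ℝ)
    (x : ℕ → Fin n → ℝ) (xbar : Fin n → ℝ)
    (hrec : ∀ k : ℕ, (Pmat (x k) + Dpart T + Lpart T).mulVec (x (k + 1)) =
      -((Upart T).mulVec (x k)) + b)
    (hconv : Filter.Tendsto x Filter.atTop (nhds xbar)) :
    vecPos xbar + T.mulVec xbar = b := by
  have hconv' : Filter.Tendsto (fun k => x (k + 1)) Filter.atTop (nhds xbar) :=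
    hconv.comp (Filter.tendsto_add_atTop_nat 1)
  have hlim := (tendsto_Pmat_mulVec hconv hconv').add
    (((tendsto_matrix_mulVec (Lpart T) hconv').add (tendsto_matrix_mulVec (Dpart T) hconv')).add
      (tendsto_matrix_mulVec (Upart T) hconv))
  rw [← Matrix.add_mulVec, ← Matrix.add_mulVec, Lpart_add_Dpart_add_Upart] at hlim
  refine tendsto_nhds_unique (hlim.congr fun k => ?_) tendsto_const_nhds
  have h := hrec k
  rw [Matrix.add_mulVec, Matrix.add_mulVec] at h
  rw [← add_neg_cancel_left ((Upart T).mulVec (x k)) b, ← h]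
  abel
end
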